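/- arXiv:2203.09586 — 10 statements merged into one kernel-verified Lean document; each statement's English description precedes it below -/
import Mathlib

section
/- For a spectrum X(R), the operator S ↦ h(k(S)) on subsets of X(R) is a Kuratowski closure operation (i.e., h(k(∅)) = ∅, S ⊆ h(k(S)), h(k(h(k(S)))) = h(k(S)), and h(k(S ∪ T)) = h(k(S)) ∪ h(k(T)) for all S, T ⊆ X(R)) if and only if X(R) satisfies the property (m.i.p.): for all ideals a, b lying in the image of k and every s ∈ X(R), a ∩ b ⊆ s implies a ⊆ s or b ⊆ s. -/
/-- The hull of an ideal `a` in a spectrum `X`: the set of members of `X` containing `a`. -/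
def hullX {R : Type*} [CommRing R] (X : Set (Ideal R)) (a : Ideal R) : Set X :=
  {s | a ≤ (s : Ideal R)}

/-- The kernel of a subset `S` of a spectrum `X`: the intersection of the members of `S`
(the improper ideal `R` if `S = ∅`). -/
def kerX {R : Type*} [CommRing R] (X : Set (Ideal R)) (S : Set X) : Ideal R :=
  ⨅ s ∈ S, (s : Ideal R)

theorem kerX_union_aux {R : Type*} [CommRing R] (X : Set (Ideal R)) (S T : Set X) :
    kerX X (S ∪ T) = kerX X S ⊓ kerX X T := by
  unfold kerX
  exact iInf_union

theorem subset_hull_aux {R : Type*} [CommRing R] (X : Set (Ideal R)) (S : Set X) :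
    S ⊆ hullX X (kerX X S) := fun s hs => iInf₂_le (f := fun (t : X) (_ : t ∈ S) => (t : Ideal R)) s hs

theorem le_ker_hull_aux {R : Type*} [CommRing R] (X : Set (Ideal R)) (a : Ideal R) :
    a ≤ kerX X (hullX X a) := le_iInf₂ fun _ hs => hs

/-- `S ↦ h(k(S))` is a Kuratowski closure operation on a spectrum `X(R)` if and only if
`X(R)` satisfies (m.i.p.): for all ideals `a`, `b` in the image of `k` and every `s ∈ X(R)`,
`a ∩ b ⊆ s` implies `a ⊆ s` or `b ⊆ s`. -/
theorem kuratowski_iff_mip {R : Type*} [CommRing R] (X : Set (Ideal R))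
    (hX : (⊤ : Ideal R) ∉ X) :
    ((hullX X (kerX X (∅ : Set X)) = ∅) ∧
     (∀ S : Set X, S ⊆ hullX X (kerX X S)) ∧
     (∀ S : Set X, hullX X (kerX X (hullX X (kerX X S))) = hullX X (kerX X S)) ∧
     (∀ S T : Set X, hullX X (kerX X (S ∪ T)) = hullX X (kerX X S) ∪ hullX X (kerX X T))) ↔
    (∀ a b : Ideal R, (∃ S : Set X, a = kerX X S) → (∃ T : Set X, b = kerX X T) →
      ∀ s : X, a ⊓ b ≤ (s : Ideal R) → a ≤ (s : Ideal R) ∨ b ≤ (s : Ideal R)) := by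
  constructor
  · rintro ⟨-, -, -, h⟩ a b ⟨S, rfl⟩ ⟨T, rfl⟩ s hs
    rw [← kerX_union_aux] at hs
    have h1 : s ∈ hullX X (kerX X (S ∪ T)) := hs
    rw [h S T] at h1
    exact h1
  · intro h
    refine ⟨?_, subset_hull_aux X, fun S => ?_, fun S T => ?_⟩
    · ext s
      constructor
      · intro hs
        have h1 : kerX X (∅ : Set X) ≤ (s : Ideal R) := hs
        have h2 : kerX X (∅ : Set X) = ⊤ := by simp [kerX]
        rw [h2, top_le_iff] at h1
        exact (hX (h1 ▸ s.2)).elim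
      · exact fun hs => hs.elim
    · refine Set.Subset.antisymm (fun s hs => ?_) (subset_hull_aux X _)
      exact le_trans (le_ker_hull_aux X _) hs
    · ext s
      constructor
      · intro hs
        have h1 : kerX X (S ∪ T) ≤ (s : Ideal R) := hs
        rw [kerX_union_aux] at h1
        exact h _ _ ⟨S, rfl⟩ ⟨T, rfl⟩ s h1
      · intro hs
        change kerX X (S ∪ T) ≤ (s : Ideal R)
        rw [kerX_union_aux]
        rcases hs with hs | hs
        · exact le_trans inf_le_left hs
        · exact le_trans inf_le_right hs
end

section
/- Let f : R → R' be a surjective ring homomorphism and let X(R), X(R') be spectra such that (a) for every b ∈ X(R') the preimage f⁻¹(b) belongs to X(R), and (b) for every s ∈ X(R) with ker f ⊆ s, the image ideal f(s) belongs to X(R'). Then the map f* : X(R') → X(R), f*(b) = f⁻¹(b), is a homeomorphism of X(R') (with the ideal-space topology) onto the subspace h(ker f) of X(R). -/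
/-- The ideal-space topology on a spectrum `X`: generated by taking the hulls `h(a)` as a
subbase for the closed sets, i.e. their complements as a subbase for the open sets. -/
def idealTop {R : Type*} [CommRing R] (X : Set (Ideal R)) : TopologicalSpace X :=
  TopologicalSpace.generateFrom {U | ∃ a : Ideal R, U = (hullX X a)ᶜ}

/-- If `f : R → R'` is a surjective ring homomorphism and the spectra satisfy the
contraction-ideal property (and images of members of `X(R)` containing `ker f` lie in `X(R')`),
then `f* : X(R') → X(R)`, `b ↦ f⁻¹(b)`, is a homeomorphism of `X(R')` onto the subspace
`h(ker f)` of `X(R)`: it is a topological embedding whose range is exactly `h(ker f)`. -/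
theorem contraction_map_homeomorph_onto_hull_ker {R R' : Type*} [CommRing R] [CommRing R']
    (f : R →+* R') (hf : Function.Surjective f)
    (X : Set (Ideal R)) (X' : Set (Ideal R'))
    (hX : (⊤ : Ideal R) ∉ X) (hX' : (⊤ : Ideal R') ∉ X')
    (hcontr : ∀ b : Ideal R', b ∈ X' → Ideal.comap f b ∈ X)
    (hext : ∀ s : Ideal R, s ∈ X → RingHom.ker f ≤ s → Ideal.map f s ∈ X') :
    @Topology.IsEmbedding _ _ (idealTop X') (idealTop X)
      (fun b : X' => (⟨Ideal.comap f b.1, hcontr b.1 b.2⟩ : X)) ∧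
    Set.range (fun b : X' => (⟨Ideal.comap f b.1, hcontr b.1 b.2⟩ : X))
      = hullX X (RingHom.ker f) := by
  letI : TopologicalSpace X := idealTop X
  letI : TopologicalSpace X' := idealTop X'
  refine ⟨⟨⟨?_⟩, ?_⟩, ?_⟩
  · change idealTop X' = TopologicalSpace.induced _ (idealTop X)
    unfold idealTop
    rw [induced_generateFrom_eq]
    congr 1
    ext U
    constructor
    · rintro ⟨a, rfl⟩
      refine ⟨_, ⟨Ideal.comap f a, rfl⟩, ?_⟩
      ext b
      simp only [hullX, Set.mem_preimage, Set.mem_compl_iff, Set.mem_setOf_eq]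
      rw [← Ideal.map_le_iff_le_comap, Ideal.map_comap_of_surjective f hf]
    · rintro ⟨_, ⟨a, rfl⟩, rfl⟩
      refine ⟨Ideal.map f a, ?_⟩
      ext b
      simp only [hullX, Set.mem_preimage, Set.mem_compl_iff, Set.mem_setOf_eq]
      rw [Ideal.map_le_iff_le_comap]
  · intro b c h
    exact Subtype.ext (Ideal.comap_injective_of_surjective f hf (congrArg Subtype.val h))
  · ext s
    constructor
    · rintro ⟨b, rfl⟩
      exact Ideal.comap_mono bot_le
    · intro hs
      refine ⟨⟨Ideal.map f s.1, hext s.1 s.2 hs⟩, Subtype.ext ?_⟩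
      change Ideal.comap f (Ideal.map f s.1) = s.1
      rw [Ideal.comap_map_of_surjective f hf]
      exact sup_eq_left.mpr hs
end

section
/- If a spectrum X(R) has the partition-of-unity property (for every ideal a of R, h(a) = ∅ implies a = R), then X(R) with the ideal-space topology is quasi-compact (every open cover has a finite subcover). -/
/-- If a spectrum `X(R)` has the partition-of-unity property, then the ideal space `X(R)`
is quasi-compact. -/
theorem quasi_compact_of_partition_of_unity {R : Type*} [CommRing R] (X : Set (Ideal R))
    (hX : (⊤ : Ideal R) ∉ X)
    (hpart : ∀ a : Ideal R, hullX X a = ∅ → a = ⊤) :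
    @CompactSpace X (idealTop X) := by
  refine @compactSpace_generateFrom X (idealTop X) _ rfl ?_
  intro P hP hcov
  have htop : sSup {a : Ideal R | (hullX X a)ᶜ ∈ P} = ⊤ := by
    apply hpart
    rw [Set.eq_empty_iff_forall_notMem]
    intro s hs
    have hsU : s ∈ ⋃₀ P := by rw [hcov]; trivial
    obtain ⟨U, hU, hsU⟩ := hsU
    obtain ⟨a, rfl⟩ := hP hU
    exact hsU (le_trans (le_sSup (show a ∈ {a : Ideal R | (hullX X a)ᶜ ∈ P} from hU)) hs)
  have hc : IsCompactElement (⊤ : Ideal R) := Ideal.isCompactElement_top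
  rw [CompleteLattice.isCompactElement_iff_exists_le_sSup_of_le_sSup] at hc
  obtain ⟨t, ht, hle⟩ := hc _ htop.ge
  refine ⟨(fun a => (hullX X a)ᶜ) '' (t : Set (Ideal R)), ?_, t.finite_toSet.image _, ?_⟩
  · rintro _ ⟨a, ha, rfl⟩
    exact ht ha
  · rw [Set.eq_univ_iff_forall]
    intro s
    by_contra hs
    apply hX
    have : (⊤ : Ideal R) ≤ (s : Ideal R) := by
      refine hle.trans (Finset.sup_le fun a ha => ?_)
      by_contra hn
      exact hs ⟨_, ⟨a, ha, rfl⟩, hn⟩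
    rw [← top_le_iff.mp this]
    exact s.2
end

section
/- Let Prp(R) be the spectrum of all proper ideals of R, with the ideal-space topology. Then every nonempty subbasic closed set h(a) (a an ideal of R) is an irreducible subset of Prp(R). -/
/-- The spectrum of all proper ideals of `R`. -/
def Prp (R : Type*) [CommRing R] : Set (Ideal R) := {I | I ≠ ⊤}

/-- In the ideal space `Prp(R)` of all proper ideals, every nonempty subbasic closed set
`h(a)` is irreducible. -/
theorem hull_irreducible_in_Prp {R : Type*} [CommRing R] (a : Ideal R)
    (h : (hullX (Prp R) a).Nonempty) :
    @IsIrreducible _ (idealTop (Prp R)) (hullX (Prp R) a) := by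
  have down : ∀ U : Set (Prp R), @IsOpen _ (idealTop (Prp R)) U →
      ∀ s t : Prp R, (t : Ideal R) ≤ s → s ∈ U → t ∈ U := by
    intro U hU
    induction hU with
    | basic V hV =>
      obtain ⟨b, rfl⟩ := hV
      intro s t hts hs ht
      exact hs (le_trans (show b ≤ (t : Ideal R) from ht) hts)
    | univ => intro s t _ _; trivial
    | inter V W _ _ ihV ihW =>
      intro s t hts hs
      exact ⟨ihV s t hts hs.1, ihW s t hts hs.2⟩
    | sUnion S _ ih =>
      intro s t hts hs
      obtain ⟨V, hV, hsV⟩ := hs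
      exact ⟨V, hV, ih V hV s t hts hsV⟩
  refine ⟨h, ?_⟩
  have ha : a ∈ Prp R := by
    obtain ⟨s, hs⟩ := h
    intro e
    exact s.2 (top_le_iff.mp (e ▸ hs))
  rintro U V hU hV ⟨s, hs, hsU⟩ ⟨t, ht, htV⟩
  exact ⟨⟨a, ha⟩, le_refl a, down U hU s ⟨a, ha⟩ hs hsU, down V hV t ⟨a, ha⟩ ht htV⟩
end

section
/- Let X(R) be a spectrum with the ideal-space topology. Every nonempty irreducible closed subset C of X(R) is a subbasic closed set: C = h(a) for some ideal a of R; indeed C = h(k(C)). -/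
/-- Every nonempty irreducible closed subset `C` of an ideal space `X(R)` is a subbasic closed
set: `C = h(a)` for some ideal `a`; indeed `C = h(k(C))`. -/
theorem irreducible_closed_is_hull {R : Type*} [CommRing R] (X : Set (Ideal R))
    (hX : (⊤ : Ideal R) ∉ X) (C : Set X) (hne : C.Nonempty)
    (hirr : @IsIrreducible _ (idealTop X) C) (hcl : @IsClosed _ (idealTop X) C) :
    (∃ a : Ideal R, C = hullX X a) ∧ C = hullX X (kerX X C) := by
  have key : C = hullX X (kerX X C) := by
    apply Set.Subset.antisymm
    · intro s hs
      have h : (⨅ t ∈ C, (t : Ideal R)) ≤ (s : Ideal R) := iInf₂_le s hs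
      exact h
    · intro x hx
      have claim : ∀ U : Set X, TopologicalSpace.GenerateOpen
          {U | ∃ a : Ideal R, U = (hullX X a)ᶜ} U → x ∈ U → (C ∩ U).Nonempty := by
        intro U hU
        induction hU with
        | basic s hs =>
          obtain ⟨a, rfl⟩ := hs
          intro hxa
          by_contra hemp
          apply hxa
          have hle : a ≤ kerX X C := by
            refine le_iInf₂ fun s hs => ?_
            by_contra hn
            exact hemp ⟨s, hs, hn⟩
          exact le_trans hle hx
        | univ => intro _; simpa using hne
        | inter s t hs ht ihs iht =>
          intro hxs
          exact hirr.2 s t hs ht (ihs hxs.1) (iht hxs.2)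
        | sUnion S hS ih =>
          rintro ⟨t, htS, hxt⟩
          obtain ⟨y, hyC, hyt⟩ := ih t htS hxt
          exact ⟨y, hyC, t, htS, hyt⟩
      by_contra hxC
      obtain ⟨y, hyC, hyn⟩ := claim Cᶜ hcl.1 hxC
      exact hyn hyC
  exact ⟨⟨_, key⟩, key⟩
end

section
/- Let X(R) be a spectrum with the ideal-space topology. Then X(R) is a sober space (every nonempty irreducible closed subset is the closure of exactly one point) if and only if for every nonempty irreducible closed subset C of X(R), the kernel k(C) = ⋂_{s ∈ C} s belongs to C; in that case k(C) is the unique generic point of C. -/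
/-- The closure of a point is the set of members of `X` containing it. -/
theorem idealTop_closure_singleton {R : Type*} [CommRing R] (X : Set (Ideal R)) (x : X) :
    @closure _ (idealTop X) {x} = hullX X (x : Ideal R) := by
  letI := idealTop X
  apply Set.Subset.antisymm
  · refine closure_minimal ?_ ?_
    · rintro y rfl
      exact le_refl (y : Ideal R)
    · rw [← isOpen_compl_iff]
      exact TopologicalSpace.isOpen_generateFrom_of_mem ⟨_, rfl⟩
  · intro y hy
    have key : ∀ U : Set X, TopologicalSpace.GenerateOpen
        {U | ∃ a : Ideal R, U = (hullX X a)ᶜ} U → y ∈ U → x ∈ U := by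
      intro U hU
      induction hU with
      | basic s hs =>
        obtain ⟨a, rfl⟩ := hs
        intro hyU hxU
        have h1 : a ≤ (x : Ideal R) := hxU
        have h2 : (x : Ideal R) ≤ y := hy
        have h3 : a ≤ (y : Ideal R) := h1.trans h2
        exact hyU h3
      | univ => intro _; trivial
      | inter s t _ _ ihs iht => exact fun h => ⟨ihs h.1, iht h.2⟩
      | sUnion S _ ih =>
        rintro ⟨t, ht, hyt⟩
        exact ⟨t, ht, ih t ht hyt⟩
    rw [mem_closure_iff]
    intro U hU hyU
    exact ⟨x, key U hU hyU, rfl⟩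

/-- The kernel of the hull of a member of `X` is that member. -/
theorem kerX_hullX {R : Type*} [CommRing R] (X : Set (Ideal R)) (x : X) :
    kerX X (hullX X (x : Ideal R)) = x := by
  apply le_antisymm
  · exact iInf₂_le x (le_refl (x : Ideal R))
  · exact le_iInf₂ fun s hs => hs

/-- If the kernel of a closed set belongs to it, it is a generic point. -/
theorem closure_kerX {R : Type*} [CommRing R] (X : Set (Ideal R)) (C : Set X)
    (hC : @IsClosed _ (idealTop X) C) (hc : kerX X C ∈ X) (hm : (⟨kerX X C, hc⟩ : X) ∈ C) :
    @closure _ (idealTop X) {(⟨kerX X C, hc⟩ : X)} = C := by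
  apply Set.Subset.antisymm
  · exact @closure_minimal _ (idealTop X) _ _ (Set.singleton_subset_iff.2 hm) hC
  · rw [idealTop_closure_singleton]
    intro s hs
    change kerX X C ≤ (s : Ideal R)
    exact iInf₂_le (f := fun (t : X) (_ : t ∈ C) => (t : Ideal R)) s hs

/-- An ideal space `X(R)` is sober (every nonempty irreducible closed subset is the closure of
exactly one point) if and only if for every nonempty irreducible closed subset `C`, the kernel
`k(C)` belongs to `C`; in that case `k(C)` is the (unique) generic point of `C`. -/
theorem sober_iff_ker_mem {R : Type*} [CommRing R] (X : Set (Ideal R))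
    (hX : (⊤ : Ideal R) ∉ X) :
    ((∀ C : Set X, @IsIrreducible _ (idealTop X) C → @IsClosed _ (idealTop X) C →
        ∃! x : X, @closure _ (idealTop X) {x} = C) ↔
      (∀ C : Set X, @IsIrreducible _ (idealTop X) C → @IsClosed _ (idealTop X) C →
        ∃ hc : kerX X C ∈ X, (⟨kerX X C, hc⟩ : X) ∈ C)) ∧
    (∀ C : Set X, @IsIrreducible _ (idealTop X) C → @IsClosed _ (idealTop X) C →
      ∀ hc : kerX X C ∈ X, (⟨kerX X C, hc⟩ : X) ∈ C →
        @closure _ (idealTop X) {(⟨kerX X C, hc⟩ : X)} = C) := by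
  refine ⟨⟨fun h C hi hC => ?_, fun h C hi hC => ?_⟩, fun C _ hC hc hm => closure_kerX X C hC hc hm⟩
  · obtain ⟨x, hx, -⟩ := h C hi hC
    rw [idealTop_closure_singleton] at hx
    subst hx
    have e := kerX_hullX X x
    refine ⟨by rw [e]; exact x.2, ?_⟩
    exact e.ge
  · obtain ⟨hc, hm⟩ := h C hi hC
    refine ⟨⟨_, hc⟩, closure_kerX X C hC hc hm, fun y hy => ?_⟩
    replace hy : @closure _ (idealTop X) {y} = C := hy
    rw [idealTop_closure_singleton] at hy
    subst hy
    exact Subtype.ext (kerX_hullX X y).symm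
end

section
/- Let Irs(R) be the spectrum of all strongly irreducible ideals of R, i.e., all proper ideals s such that for all ideals a, b of R, a ∩ b ⊆ s implies a ⊆ s or b ⊆ s. Then Irs(R) with the ideal-space topology is a sober space: every nonempty irreducible closed subset is the closure of exactly one point. -/
/-- The spectrum of all strongly irreducible ideals of `R`: proper ideals `s` such that
`a ∩ b ≤ s` implies `a ≤ s` or `b ≤ s` for all ideals `a`, `b`. -/
def Irs (R : Type*) [CommRing R] : Set (Ideal R) :=
  {s | s ≠ ⊤ ∧ ∀ a b : Ideal R, a ⊓ b ≤ s → a ≤ s ∨ b ≤ s}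

theorem Irs_isOpen_aux {R : Type*} [CommRing R] (U : Set (Irs R))
    (hU : @IsOpen _ (idealTop (Irs R)) U) : ∃ a : Ideal R, U = (hullX (Irs R) a)ᶜ := by
  have hU' : TopologicalSpace.GenerateOpen {U | ∃ a : Ideal R, U = (hullX (Irs R) a)ᶜ} U := hU
  clear hU
  induction hU' with
  | basic s hs => exact hs
  | univ =>
    refine ⟨⊤, ?_⟩
    ext x
    simp only [Set.mem_univ, Set.mem_compl_iff, hullX, Set.mem_ofPred_eq, true_iff]
    intro h
    exact x.2.1 (top_le_iff.mp h)
  | inter s t _ _ hs ht =>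
    obtain ⟨a, rfl⟩ := hs
    obtain ⟨b, rfl⟩ := ht
    refine ⟨a ⊓ b, ?_⟩
    ext x
    simp only [Set.mem_inter_iff, Set.mem_compl_iff, hullX, Set.mem_ofPred_eq]
    constructor
    · rintro ⟨h1, h2⟩ h
      exact (x.2.2 a b h).elim h1 h2
    · intro h
      exact ⟨fun h1 => h (inf_le_left.trans h1), fun h1 => h (inf_le_right.trans h1)⟩
  | sUnion S _ ih =>
    refine ⟨sSup {a | (hullX (Irs R) a)ᶜ ∈ S}, ?_⟩
    ext x
    simp only [Set.mem_sUnion, Set.mem_compl_iff]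
    constructor
    · rintro ⟨t, ht, hx⟩ h
      obtain ⟨a, rfl⟩ := ih t ht
      exact hx ((le_sSup (show a ∈ {a | (hullX (Irs R) a)ᶜ ∈ S} from ht)).trans h)
    · intro h
      by_contra hc
      apply h
      change sSup _ ≤ (x : Ideal R)
      refine sSup_le fun a ha => ?_
      by_contra hx
      exact hc ⟨_, ha, hx⟩

theorem Irs_isClosed_hull {R : Type*} [CommRing R] (a : Ideal R) :
    @IsClosed _ (idealTop (Irs R)) (hullX (Irs R) a) := by
  letI := idealTop (Irs R)
  rw [← isOpen_compl_iff]
  exact TopologicalSpace.isOpen_generateFrom_of_mem ⟨a, rfl⟩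

theorem Irs_closed_aux {R : Type*} [CommRing R] (C : Set (Irs R))
    (hC : @IsClosed _ (idealTop (Irs R)) C) : ∃ a : Ideal R, C = hullX (Irs R) a := by
  letI := idealTop (Irs R)
  obtain ⟨a, ha⟩ := Irs_isOpen_aux Cᶜ hC.isOpen_compl
  exact ⟨a, compl_injective ha⟩

theorem Irs_closure_aux {R : Type*} [CommRing R] (x : Irs R) :
    @closure _ (idealTop (Irs R)) {x} = hullX (Irs R) (x : Ideal R) := by
  letI := idealTop (Irs R)
  apply Set.Subset.antisymm
  · exact closure_minimal (Set.singleton_subset_iff.mpr (le_refl (x : Ideal R)))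
      (Irs_isClosed_hull _)
  · obtain ⟨a, ha⟩ := Irs_closed_aux (closure {x}) isClosed_closure
    have hx : x ∈ closure {x} := subset_closure rfl
    rw [ha] at hx ⊢
    intro y hy
    exact le_trans (show a ≤ (x : Ideal R) from hx) hy

/-- The ideal space `Irs(R)` of strongly irreducible ideals is sober: every nonempty
irreducible closed subset is the closure of exactly one point. -/
theorem Irs_sober {R : Type*} [CommRing R] :
    ∀ C : Set (Irs R), @IsIrreducible _ (idealTop (Irs R)) C →
      @IsClosed _ (idealTop (Irs R)) C →
      ∃! x : Irs R, @closure _ (idealTop (Irs R)) {x} = C := by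
  intro C hI hC
  letI := idealTop (Irs R)
  obtain ⟨a, rfl⟩ := Irs_closed_aux C hC
  obtain ⟨⟨y, hy⟩, hp⟩ := hI
  have hs : sInf (Set.image Subtype.val (hullX (Irs R) a)) ∈ Irs R := by
    refine ⟨fun h => y.2.1 (top_le_iff.mp (h ▸ sInf_le ⟨y, hy, rfl⟩)), fun b c hbc => ?_⟩
    have hsub : hullX (Irs R) a ⊆ hullX (Irs R) b ∪ hullX (Irs R) c := fun z hz =>
      z.2.2 b c (hbc.trans (sInf_le ⟨z, hz, rfl⟩))
    rcases isPreirreducible_iff_isClosed_union_isClosed.mp hp _ _ (Irs_isClosed_hull b)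
      (Irs_isClosed_hull c) hsub with h | h
    · left
      refine le_sInf ?_
      rintro _ ⟨z, hz, rfl⟩
      exact h hz
    · right
      refine le_sInf ?_
      rintro _ ⟨z, hz, rfl⟩
      exact h hz
  refine ⟨⟨_, hs⟩, ?_, ?_⟩
  · change closure _ = _
    rw [Irs_closure_aux]
    apply Set.Subset.antisymm
    · intro z hz
      change sInf (Set.image Subtype.val (hullX (Irs R) a)) ≤ (z : Ideal R) at hz
      change a ≤ (z : Ideal R)
      refine le_trans (le_sInf ?_) hz
      rintro _ ⟨w, hw, rfl⟩
      exact hw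
    · intro z hz
      change sInf (Set.image Subtype.val (hullX (Irs R) a)) ≤ (z : Ideal R)
      exact sInf_le ⟨z, hz, rfl⟩
  · intro x hx
    change closure _ = _ at hx
    rw [Irs_closure_aux] at hx
    apply Subtype.ext
    apply le_antisymm
    · refine le_sInf ?_
      rintro _ ⟨w, hw, rfl⟩
      rw [← hx] at hw
      exact hw
    · refine sInf_le ⟨x, ?_, rfl⟩
      rw [← hx]
      exact le_refl (x : Ideal R)
end

section
/- Let Y be a quasi-compact topological space that is disconnected, i.e., there exist nonempty closed sets A and B with A ∪ B = Y and A ∩ B = ∅. Let 𝓑 be a family of closed subsets of Y such that every closed subset of Y is an intersection of members of 𝓑, and such that 𝓑 is closed under binary intersections. Then 𝓑 strongly disconnects Y: there exist nonempty sets A', B' ∈ 𝓑 with A' ∪ B' = Y and A' ∩ B' = ∅. -/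
theorem mem_base_of_clopen_aux {Y : Type*} [TopologicalSpace Y] [CompactSpace Y]
    (𝓑 : Set (Set Y))
    (hcl : ∀ C ∈ 𝓑, IsClosed C)
    (hbase : ∀ C : Set Y, IsClosed C → ∃ 𝒜 ⊆ 𝓑, C = ⋂₀ 𝒜)
    (hinter : ∀ A ∈ 𝓑, ∀ B ∈ 𝓑, A ∩ B ∈ 𝓑)
    (A B : Set Y) (hA : IsClosed A) (hB : IsClosed B) (hBn : B.Nonempty)
    (hu : A ∪ B = Set.univ) (hi : A ∩ B = ∅) : A ∈ 𝓑 := by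
  classical
  obtain ⟨𝒜, h𝒜, rfl⟩ := hbase A hA
  obtain ⟨u, hu'⟩ := hB.isCompact.elim_finite_subfamily_closed (fun i : 𝒜 => (i : Set Y))
    (fun i => hcl _ (h𝒜 i.2)) (by rw [← Set.sInter_eq_iInter, Set.inter_comm]; exact hi)
  have key : ∀ v : Finset 𝒜, (⋂ i ∈ v, (i : Set Y)) = Set.univ ∨ (⋂ i ∈ v, (i : Set Y)) ∈ 𝓑 := by
    intro v
    induction v using Finset.induction_on with
    | empty => left; simp
    | insert a s _ ih =>
      right
      rw [Finset.set_biInter_insert]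
      rcases ih with ih | ih
      · rw [ih, Set.inter_univ]; exact h𝒜 a.2
      · exact hinter _ (h𝒜 a.2) _ ih
  have heq : (⋂ i ∈ u, (i : Set Y)) = ⋂₀ 𝒜 := by
    apply Set.Subset.antisymm
    · intro x hx
      rcases (hu ▸ Set.mem_univ x : x ∈ ⋂₀ 𝒜 ∪ B) with h | h
      · exact h
      · exact absurd (show x ∈ B ∩ ⋂ i ∈ u, (i : Set Y) from ⟨h, hx⟩) (by rw [hu']; simp)
    · intro x hx
      exact Set.mem_iInter₂.2 fun i _ => hx _ i.2
  rcases key u with h | h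
  · obtain ⟨x, hx⟩ := hBn
    exact absurd (show x ∈ B ∩ ⋂ i ∈ u, (i : Set Y) from ⟨hx, h ▸ Set.mem_univ x⟩)
      (by rw [hu']; simp)
  · exact heq ▸ h

/-- If a quasi-compact space is disconnected, then every family of closed sets that is a closed
base (every closed set is an intersection of members) and is closed under binary intersections
strongly disconnects the space. -/
theorem closed_base_strongly_disconnects {Y : Type*} [TopologicalSpace Y] [CompactSpace Y]
    (hdis : ∃ A B : Set Y, IsClosed A ∧ IsClosed B ∧ A.Nonempty ∧ B.Nonempty ∧
      A ∪ B = Set.univ ∧ A ∩ B = ∅)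
    (𝓑 : Set (Set Y))
    (hcl : ∀ C ∈ 𝓑, IsClosed C)
    (hbase : ∀ C : Set Y, IsClosed C → ∃ 𝒜 ⊆ 𝓑, C = ⋂₀ 𝒜)
    (hinter : ∀ A ∈ 𝓑, ∀ B ∈ 𝓑, A ∩ B ∈ 𝓑) :
    ∃ A ∈ 𝓑, ∃ B ∈ 𝓑, A.Nonempty ∧ B.Nonempty ∧ A ∪ B = Set.univ ∧ A ∩ B = ∅ := by
  obtain ⟨A, B, hA, hB, hAn, hBn, hu, hi⟩ := hdis
  exact ⟨A, mem_base_of_clopen_aux 𝓑 hcl hbase hinter A B hA hB hBn hu hi,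
    B, mem_base_of_clopen_aux 𝓑 hcl hbase hinter B A hB hA hAn
      (by rw [Set.union_comm]; exact hu) (by rw [Set.inter_comm]; exact hi), hAn, hBn, hu, hi⟩
end

section
/- Let X(R) be a spectrum such that X(R) with the ideal-space topology is quasi-compact. Then X(R) is disconnected (there exist nonempty closed sets A, B with A ∪ B = X(R) and A ∩ B = ∅) if and only if the closed base B_h strongly disconnects X(R), i.e., there exist two nonempty sets, each a finite union of hulls h(a), that are disjoint and whose union is all of X(R). -/
/-- The closed base `B_h`: all finite unions of hulls. -/
def Bh {R : Type*} [CommRing R] (X : Set (Ideal R)) : Set (Set X) :=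
  {S | ∃ (n : ℕ) (a : Fin n → Ideal R), S = ⋃ i, hullX X (a i)}

theorem mem_Bh_iff {R : Type*} [CommRing R] (X : Set (Ideal R)) (S : Set X) :
    S ∈ Bh X ↔ ∃ F : Set (Ideal R), F.Finite ∧ S = {s : X | ∃ a ∈ F, a ≤ (s : Ideal R)} := by
  constructor
  · rintro ⟨n, a, rfl⟩
    refine ⟨Set.range a, Set.finite_range a, ?_⟩
    ext s
    simp [hullX]
  · rintro ⟨F, hF, rfl⟩
    obtain ⟨n, f, -, rfl⟩ := hF.fin_param
    refine ⟨n, f, ?_⟩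
    ext s
    simp [hullX]

theorem Bh_union {R : Type*} [CommRing R] (X : Set (Ideal R)) {S T : Set X}
    (hS : S ∈ Bh X) (hT : T ∈ Bh X) : S ∪ T ∈ Bh X := by
  rw [mem_Bh_iff] at *
  obtain ⟨F, hF, rfl⟩ := hS
  obtain ⟨G, hG, rfl⟩ := hT
  refine ⟨F ∪ G, hF.union hG, ?_⟩
  ext s
  simp only [Set.mem_union, Set.mem_setOf_eq]
  grind

theorem Bh_inter {R : Type*} [CommRing R] (X : Set (Ideal R)) {S T : Set X}
    (hS : S ∈ Bh X) (hT : T ∈ Bh X) : S ∩ T ∈ Bh X := by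
  rw [mem_Bh_iff] at *
  obtain ⟨F, hF, rfl⟩ := hS
  obtain ⟨G, hG, rfl⟩ := hT
  refine ⟨Set.image2 (· ⊔ ·) F G, hF.image2 _ hG, ?_⟩
  ext s
  constructor
  · rintro ⟨⟨a, ha, has⟩, ⟨b, hb, hbs⟩⟩
    exact ⟨a ⊔ b, ⟨a, ha, b, hb, rfl⟩, sup_le has hbs⟩
  · rintro ⟨_, ⟨a, ha, b, hb, rfl⟩, h⟩
    exact ⟨⟨a, ha, le_sup_left.trans h⟩, ⟨b, hb, le_sup_right.trans h⟩⟩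

theorem Bh_empty {R : Type*} [CommRing R] (X : Set (Ideal R)) : (∅ : Set X) ∈ Bh X := by
  rw [mem_Bh_iff]
  exact ⟨∅, Set.finite_empty, by simp⟩

theorem Bh_univ {R : Type*} [CommRing R] (X : Set (Ideal R)) : (Set.univ : Set X) ∈ Bh X := by
  rw [mem_Bh_iff]
  exact ⟨{⊥}, Set.finite_singleton _, by simp⟩

theorem hullX_mem_Bh {R : Type*} [CommRing R] (X : Set (Ideal R)) (a : Ideal R) :
    hullX X a ∈ Bh X := by
  rw [mem_Bh_iff]
  exact ⟨{a}, Set.finite_singleton _, by simp [hullX]⟩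

theorem isClosed_of_mem_Bh {R : Type*} [CommRing R] (X : Set (Ideal R)) {S : Set X}
    (hS : S ∈ Bh X) : @IsClosed _ (idealTop X) S := by
  letI := idealTop X
  obtain ⟨n, a, rfl⟩ := hS
  refine isClosed_iUnion_of_finite fun i => ⟨?_⟩
  exact TopologicalSpace.GenerateOpen.basic _ ⟨a i, rfl⟩

theorem Bh_base {R : Type*} [CommRing R] (X : Set (Ideal R)) {U : Set X}
    (hU : @IsOpen _ (idealTop X) U) (x : X) (hx : x ∈ U) :
    ∃ S ∈ Bh X, x ∈ Sᶜ ∧ Sᶜ ⊆ U := by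
  change TopologicalSpace.GenerateOpen _ U at hU
  induction hU with
  | basic s hs =>
    obtain ⟨a, rfl⟩ := hs
    exact ⟨_, hullX_mem_Bh X a, hx, subset_rfl⟩
  | univ => exact ⟨∅, Bh_empty X, by simp, Set.subset_univ _⟩
  | inter s t _ _ hs ht =>
    obtain ⟨S, hS, h1, h2⟩ := hs hx.1
    obtain ⟨T, hT, h3, h4⟩ := ht hx.2
    refine ⟨S ∪ T, Bh_union X hS hT, ?_, ?_⟩
    · rw [Set.compl_union]; exact ⟨h1, h3⟩
    · rw [Set.compl_union]; exact Set.inter_subset_inter h2 h4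
  | sUnion 𝒮 _ ih =>
    obtain ⟨t, ht, hxt⟩ := hx
    obtain ⟨S, hS, h1, h2⟩ := ih t ht hxt
    exact ⟨S, hS, h1, h2.trans (Set.subset_sUnion_of_mem ht)⟩

theorem Bh_of_clopen {R : Type*} [CommRing R] (X : Set (Ideal R))
    (hcomp : @CompactSpace X (idealTop X)) {A : Set X} (hA : @IsClosed _ (idealTop X) A)
    (hA' : @IsClosed _ (idealTop X) Aᶜ) : A ∈ Bh X := by
  letI := idealTop X
  have hK : IsCompact Aᶜ := hA'.isCompact
  have key : ∃ S ∈ Bh X, Aᶜ ⊆ Sᶜ ∧ Sᶜ ⊆ Aᶜ := by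
    refine hK.induction_on (p := fun K => ∃ S ∈ Bh X, K ⊆ Sᶜ ∧ Sᶜ ⊆ Aᶜ) ?_ ?_ ?_ ?_
    · exact ⟨Set.univ, Bh_univ X, by simp, by simp⟩
    · rintro s t hst ⟨S, hS, h1, h2⟩
      exact ⟨S, hS, hst.trans h1, h2⟩
    · rintro s t ⟨S, hS, h1, h2⟩ ⟨T, hT, h3, h4⟩
      refine ⟨S ∩ T, Bh_inter X hS hT, ?_, ?_⟩
      · rw [Set.compl_inter]; exact Set.union_subset_union h1 h3
      · rw [Set.compl_inter]; exact Set.union_subset h2 h4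
    · intro x hx
      obtain ⟨S, hS, h1, h2⟩ := Bh_base X hA.isOpen_compl x hx
      exact ⟨Sᶜ, mem_nhdsWithin_of_mem_nhds
        ((isClosed_of_mem_Bh X hS).isOpen_compl.mem_nhds h1), S, hS, subset_rfl, h2⟩
  obtain ⟨S, hS, h1, h2⟩ := key
  rwa [compl_injective (h1.antisymm h2)]

/-- A quasi-compact ideal space `X(R)` is disconnected if and only if the closed base `B_h`
strongly disconnects it: there exist two nonempty members of `B_h` that are disjoint and
whose union is all of `X(R)`. -/
theorem disconnected_iff_Bh_strongly_disconnects {R : Type*} [CommRing R] (X : Set (Ideal R))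
    (hX : (⊤ : Ideal R) ∉ X) (hcomp : @CompactSpace X (idealTop X)) :
    (∃ A B : Set X, @IsClosed _ (idealTop X) A ∧ @IsClosed _ (idealTop X) B ∧
      A.Nonempty ∧ B.Nonempty ∧ A ∪ B = Set.univ ∧ A ∩ B = ∅) ↔
    (∃ A ∈ Bh X, ∃ B ∈ Bh X, A.Nonempty ∧ B.Nonempty ∧ A ∪ B = Set.univ ∧ A ∩ B = ∅) := by
  constructor
  · rintro ⟨A, B, hA, hB, hAn, hBn, hu, hi⟩
    have hc : Aᶜ = B := by
      exact (IsCompl.of_eq hi hu).compl_eq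
    have hc' : Bᶜ = A := by rw [← hc, compl_compl]
    exact ⟨A, Bh_of_clopen X hcomp hA (hc ▸ hB), B, Bh_of_clopen X hcomp hB (hc' ▸ hA),
      hAn, hBn, hu, hi⟩
  · rintro ⟨A, hA, B, hB, h⟩
    exact ⟨A, B, isClosed_of_mem_Bh X hA, isClosed_of_mem_Bh X hB, h⟩
end

section
/- Suppose R has zero Jacobson radical (the intersection of all maximal ideals of R is the zero ideal) and the spectrum X(R) contains every maximal ideal of R. If there exist ideals a and b of R with h(a) ≠ ∅, h(b) ≠ ∅, h(a) ∩ h(b) = ∅, and h(a) ∪ h(b) = X(R), then R has a non-trivial idempotent element: there exists e ∈ R with e·e = e, e ≠ 0, and e ≠ 1. -/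
/-- If `R` has zero Jacobson radical (the intersection of all maximal ideals is the zero ideal)
and the spectrum `X(R)` contains every maximal ideal, then the existence of ideals `a`, `b`
with `h(a)` and `h(b)` nonempty, disjoint, and covering `X(R)` yields a non-trivial idempotent
element of `R`. -/
theorem exists_nontrivial_idempotent_of_strongly_disconnected {R : Type*} [CommRing R]
    (X : Set (Ideal R)) (hX : (⊤ : Ideal R) ∉ X)
    (hjac : sInf {m : Ideal R | m.IsMaximal} = ⊥)
    (hmax : ∀ m : Ideal R, m.IsMaximal → m ∈ X)
    (a b : Ideal R)
    (hna : (hullX X a).Nonempty) (hnb : (hullX X b).Nonempty)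
    (hdisj : hullX X a ∩ hullX X b = ∅)
    (hcover : hullX X a ∪ hullX X b = Set.univ) :
    ∃ e : R, e * e = e ∧ e ≠ 0 ∧ e ≠ 1 := by
  have hab : a ⊔ b = ⊤ := by
    by_contra h
    obtain ⟨m, hm, hle⟩ := Ideal.exists_le_maximal _ h
    have : (⟨m, hmax m hm⟩ : X) ∈ hullX X a ∩ hullX X b :=
      ⟨le_trans le_sup_left hle, le_trans le_sup_right hle⟩
    rw [hdisj] at this
    exact this
  have h1 : (1 : R) ∈ a ⊔ b := by rw [hab]; trivial
  obtain ⟨x, hx, y, hy, hxy⟩ := Submodule.mem_sup.mp h1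
  have h0 : x * y = 0 := by
    have : x * y ∈ sInf {m : Ideal R | m.IsMaximal} := by
      rw [Submodule.mem_sInf]
      intro m hm
      have hc : (⟨m, hmax m hm⟩ : X) ∈ hullX X a ∪ hullX X b := by
        rw [hcover]; trivial
      rcases hc with hc | hc
      · exact Ideal.mul_mem_right y m (hc hx)
      · exact Ideal.mul_mem_left m x (hc hy)
    rw [hjac] at this
    exact this
  refine ⟨x, ?_, ?_, ?_⟩
  · linear_combination x * hxy - h0
  · rintro rfl
    obtain ⟨s, hs⟩ := hnb
    rw [zero_add] at hxy
    subst hxy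
    exact hX ((Ideal.eq_top_iff_one _).mpr (hs hy) ▸ s.2)
  · rintro rfl
    obtain ⟨s, hs⟩ := hna
    exact hX ((Ideal.eq_top_iff_one _).mpr (hs hx) ▸ s.2)
end
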